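/- Let φ be a flow on a generalized Peano continuum M and let Λ be a compact minimal set. Then at least one of the following holds: (1) every neighborhood of Λ in M contains a Lyapunov unstable compact minimal set; (2) Λ is an attractor; (3) for every neighborhood W of Λ in M there exists a compact, connected, positively invariant neighborhood U ⊆ W of Λ such that (a) every compact minimal set contained in U is hyper-stable and the set of compact minimal sets contained in U, with the Hausdorff metric, is a compact, connected, locally connected metric space with more than one element (a non-degenerate Peano continuum), and (b) for each x ∈ U, ω(x) is a compact minimal set contained in U, and if x ∉ ω(x) then the negative orbit {φ(t,x) : t ≤ 0} is not contained in U. -/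

import Mathlib

open Set Filter Topology Metric TopologicalSpace

variable {M : Type*} [MetricSpace M]

/-- A set is invariant under the flow `φ`. -/
def IsFlowInvariant (φ : ℝ → M → M) (K : Set M) : Prop :=
  ∀ x ∈ K, ∀ t : ℝ, φ t x ∈ K

/-- A set is positively invariant under the flow `φ`. -/
def IsPosInvariant (φ : ℝ → M → M) (K : Set M) : Prop :=
  ∀ x ∈ K, ∀ t : ℝ, 0 ≤ t → φ t x ∈ K

/-- A compact minimal set: nonempty, compact, invariant, with no nonempty proper
closed invariant subset. -/
def IsCompactMinimalSet (φ : ℝ → M → M) (K : Set M) : Prop :=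
  K.Nonempty ∧ IsCompact K ∧ IsFlowInvariant φ K ∧
    ∀ K' ⊆ K, K'.Nonempty → IsClosed K' → IsFlowInvariant φ K' → K' = K

/-- Lyapunov stability: every neighborhood of `K` contains a positively invariant
neighborhood of `K`. -/
def IsLyapunovStable (φ : ℝ → M → M) (K : Set M) : Prop :=
  ∀ U ∈ 𝓝ˢ K, ∃ V ∈ 𝓝ˢ K, V ⊆ U ∧ IsPosInvariant φ V

/-- The ω-limit set of a point. -/
def omegaLimitSet (φ : ℝ → M → M) (x : M) : Set M :=
  ⋂ T ∈ Ici (0 : ℝ), closure ((fun t => φ t x) '' Ici T)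

/-- The α-limit set of a point. -/
def alphaLimitSet (φ : ℝ → M → M) (x : M) : Set M :=
  ⋂ T ∈ Iic (0 : ℝ), closure ((fun t => φ t x) '' Iic T)

/-- A compact minimal set is hyper-stable if some neighborhood of it in `M` meets no
Lyapunov unstable compact minimal set. -/
def IsHyperStable (φ : ℝ → M → M) (Λ : Set M) : Prop :=
  IsCompactMinimalSet φ Λ ∧ ∃ W ∈ 𝓝ˢ Λ, ∀ Γ : Set M,
    IsCompactMinimalSet φ Γ → ¬ IsLyapunovStable φ Γ → Γ ∩ W = ∅

/-- An attractor: a Lyapunov stable nonempty compact invariant set whose basin of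
attraction is a neighborhood of it. -/
def IsAttractorSet (φ : ℝ → M → M) (Δ : Set M) : Prop :=
  Δ.Nonempty ∧ IsCompact Δ ∧ IsFlowInvariant φ Δ ∧ IsLyapunovStable φ Δ ∧
    {x : M | (omegaLimitSet φ x).Nonempty ∧ omegaLimitSet φ x ⊆ Δ} ∈ 𝓝ˢ Δ

/-- The flow is non-wandering. -/
def IsNonWanderingFlow (φ : ℝ → M → M) : Prop :=
  ∀ x : M, ∀ U ∈ 𝓝 x, ∀ T > (0 : ℝ), ∃ t ≥ T, ((fun y => φ t y) '' U ∩ U).Nonempty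

/-- The set of hyper-stable compact minimal sets, as a subset of the space of nonempty
compact subsets of `M` (with the Hausdorff metric). -/
def HSset (φ : ℝ → M → M) : Set (NonemptyCompacts M) :=
  {Γ | IsHyperStable φ (Γ : Set M)}

/-- The set of all compact minimal sets, as a subset of the space of nonempty compact
subsets of `M` (with the Hausdorff metric). -/
def CMinSet (φ : ℝ → M → M) : Set (NonemptyCompacts M) :=
  {Γ | IsCompactMinimalSet φ (Γ : Set M)}

/-- `basinOf φ X` is the set of points whose ω-limit set belongs to `X`. -/
def basinOf (φ : ℝ → M → M) (X : Set (NonemptyCompacts M)) : Set M :=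
  {x | ∃ Γ ∈ X, (Γ : Set M) = omegaLimitSet φ x}

/-- The union in `M` of a family of hyper-stable compact minimal sets. -/
def unionSet (φ : ℝ → M → M) (X : Set ↥(HSset φ)) : Set M :=
  {y | ∃ q ∈ X, y ∈ ((q : NonemptyCompacts M) : Set M)}

theorem exists_isCompact_cthickening_subset [LocallyCompactSpace M] {K W : Set M}
    (hK : IsCompact K) (hW : W ∈ 𝓝ˢ K) :
    ∃ δ > 0, IsCompact (cthickening δ K) ∧ cthickening δ K ⊆ W := by
  obtain ⟨δ₁, h₁, hc⟩ := hK.exists_isCompact_cthickening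
  obtain ⟨δ₂, h₂, hs⟩ := (hasBasis_nhdsSet_cthickening hK).mem_iff.1 hW
  exact ⟨min δ₁ δ₂, lt_min h₁ h₂,
    hc.of_isClosed_subset isClosed_cthickening (cthickening_mono (min_le_left _ _) _),
    (cthickening_mono (min_le_right _ _) _).trans hs⟩

/-- A set covered, at every scale, by finitely many small preconnected subsets
(Sierpiński's property S). -/
def HasPropertyS (G : Set M) : Prop :=
  ∀ ε > 0, ∃ F : Set (Set M), F.Finite ∧ ⋃₀ F = G ∧
    ∀ C ∈ F, IsPreconnected C ∧ ∃ y, C ⊆ closedBall y ε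

theorem HasPropertyS.closure {G : Set M} (hG : HasPropertyS G) : HasPropertyS (closure G) := by
  intro ε hε
  obtain ⟨F, hF, rfl, h⟩ := hG ε hε
  refine ⟨_root_.closure '' F, hF.image _, ?_, ?_⟩
  · rw [hF.closure_sUnion, sUnion_image]
  · rintro _ ⟨C, hC, rfl⟩
    obtain ⟨hp, y, hy⟩ := h C hC
    exact ⟨hp.closure, y, closure_minimal hy isClosed_closedBall⟩

theorem HasPropertyS.locallyConnectedSpace {N : Set M} (hN : HasPropertyS N) (hcl : IsClosed N) :
    LocallyConnectedSpace N := by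
  rw [locallyConnectedSpace_iff_connected_subsets]
  intro x U hU
  obtain ⟨V, hV, hVU⟩ := (mem_nhds_subtype _ _ _).1 hU
  obtain ⟨r, hr, hrV⟩ := Metric.mem_nhds_iff.1 hV
  obtain ⟨F, hF, hFN, h⟩ := hN (r / 3) (by positivity)
  set A : Set (Set M) := {C ∈ F | (x : M) ∈ _root_.closure C}
  have hsub : ⋃ C ∈ A, _root_.closure C ⊆ N :=
    iUnion₂_subset fun C hC => closure_minimal (hFN ▸ subset_sUnion_of_mem hC.1) hcl
  have hpre : IsPreconnected (⋃ C ∈ A, _root_.closure C) := by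
    refine isPreconnected_of_forall (x : M) fun y hy => ?_
    obtain ⟨C, hC, hyC⟩ := mem_iUnion₂.1 hy
    exact ⟨_root_.closure C, subset_biUnion_of_mem (u := fun C => _root_.closure C) hC, hC.2, hyC,
      (h C hC.1).1.closure⟩
  refine ⟨Subtype.val ⁻¹' (⋃ C ∈ A, _root_.closure C), ?_, ?_, ?_⟩
  · set B : Set (Set M) := {C ∈ F | (x : M) ∉ _root_.closure C} with hB
    have hBc : IsClosed (⋃ C ∈ B, _root_.closure C) :=
      (hF.subset (sep_subset _ _)).isClosed_biUnion fun _ _ => isClosed_closure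
    have hx : (x : M) ∈ (⋃ C ∈ B, _root_.closure C)ᶜ := by
      simp [hB]
    refine mem_of_superset ((hBc.isOpen_compl.preimage continuous_subtype_val).mem_nhds hx) ?_
    intro y hy
    have hyN : (y : M) ∈ ⋃₀ F := hFN ▸ y.2
    obtain ⟨C, hC, hyC⟩ := hyN
    refine mem_iUnion₂.2 ⟨C, ⟨hC, ?_⟩, subset_closure hyC⟩
    by_contra hn
    exact hy (mem_iUnion₂.2 ⟨C, ⟨hC, hn⟩, subset_closure hyC⟩)
  · refine Topology.IsInducing.subtypeVal.isPreconnected_image.1 ?_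
    rwa [Subtype.image_preimage_coe, inter_eq_right.2 hsub]
  · intro y hy
    obtain ⟨C, hC, hyC⟩ := mem_iUnion₂.1 hy
    obtain ⟨-, z, hz⟩ := h C hC.1
    have hz' := closure_minimal hz isClosed_closedBall
    have h1 := mem_closedBall.1 (hz' hyC)
    have h2 := mem_closedBall'.1 (hz' hC.2)
    refine hVU (hrV (mem_ball.2 ?_))
    linarith [dist_triangle (y : M) z x]

/-- Iterated enlargement of `A` by connected pieces of geometrically decreasing size. -/
def connectedEnlargement (A : Set M) (ε : ℝ) : ℕ → Set M
  | 0 => A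
  | n + 1 => ⋃ z ∈ connectedEnlargement A ε n, connectedComponentIn (closedBall z (ε / 2 ^ n)) z

theorem connectedEnlargement_subset_succ (A : Set M) {ε : ℝ} (hε : 0 < ε) (n : ℕ) :
    connectedEnlargement A ε n ⊆ connectedEnlargement A ε (n + 1) := fun z hz =>
  mem_iUnion₂.2 ⟨z, hz, mem_connectedComponentIn (mem_closedBall_self (by positivity))⟩

/-- Every point of a later stage is joined to stage `n` by a small connected set. -/
theorem exists_isPreconnected_of_mem_connectedEnlargement (A : Set M) {ε : ℝ} (hε : 0 < ε)
    {n m : ℕ} (hnm : n ≤ m) : ∀ x ∈ connectedEnlargement A ε m,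
      ∃ y ∈ connectedEnlargement A ε n, ∃ C, IsPreconnected C ∧ y ∈ C ∧ x ∈ C ∧
        C ⊆ closedBall y (2 * (ε / 2 ^ n) - 2 * (ε / 2 ^ m)) ∧
        C ⊆ ⋃ k, connectedEnlargement A ε k := by
  induction m, hnm using Nat.le_induction with
  | base =>
    intro x hx
    exact ⟨x, hx, {x}, isPreconnected_singleton, rfl, rfl, by simp,
      singleton_subset_iff.2 (mem_iUnion.2 ⟨n, hx⟩)⟩
  | succ m hnm ih =>
    intro x hx
    obtain ⟨z, hz, hxz⟩ := mem_iUnion₂.1 hx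
    obtain ⟨y, hy, C, hC, hyC, hzC, hCb, hCG⟩ := ih z hz
    have hpos : 0 < ε / 2 ^ m := by positivity
    have hzz : z ∈ connectedComponentIn (closedBall z (ε / 2 ^ m)) z :=
      mem_connectedComponentIn (mem_closedBall_self hpos.le)
    have hhalf : ε / 2 ^ (m + 1) = ε / 2 ^ m / 2 := by rw [pow_succ]; field_simp
    refine ⟨y, hy, C ∪ connectedComponentIn (closedBall z (ε / 2 ^ m)) z,
      hC.union z hzC hzz isPreconnected_connectedComponentIn, .inl hyC, .inr hxz, ?_, ?_⟩
    · refine union_subset (hCb.trans (closedBall_subset_closedBall ?_)) ?_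
      · rw [hhalf]; linarith
      · intro w hw
        have h1 := mem_closedBall.1 (connectedComponentIn_subset _ _ hw)
        have h2 := mem_closedBall.1 (hCb hzC)
        rw [mem_closedBall, hhalf]
        linarith [dist_triangle w z y]
    · exact union_subset hCG
        ((subset_biUnion_of_mem (u := fun z => connectedComponentIn (closedBall z (ε / 2 ^ m)) z)
          hz).trans (subset_iUnion (connectedEnlargement A ε) (m + 1)))

/-- In a locally compact, locally connected metric space, a compact connected set has arbitrarily
small compact, connected, locally connected neighborhoods. -/
theorem exists_isCompact_locallyConnected_nhdsSet [LocallyCompactSpace M] [LocallyConnectedSpace M]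
    {K W : Set M} (hK : IsCompact K) (hKc : IsConnected K) (hW : W ∈ 𝓝ˢ K) :
    ∃ N ∈ 𝓝ˢ K, N ⊆ W ∧ IsCompact N ∧ IsConnected N ∧ LocallyConnectedSpace N := by
  obtain ⟨δ, hδ, hcomp, hsub⟩ := exists_isCompact_cthickening_subset hK hW
  set ε := δ / 2 with hεδ
  have hε : 0 < ε := by positivity
  set G : ℕ → Set M := connectedEnlargement K ε
  have hpos : ∀ n : ℕ, 0 < ε / 2 ^ n := fun n => by positivity
  have hKG : K ⊆ ⋃ n, G n := subset_iUnion G 0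
  have chain : ∀ n, ∀ x ∈ ⋃ k, G k, ∃ y ∈ G n, ∃ C, IsPreconnected C ∧ y ∈ C ∧ x ∈ C ∧
      C ⊆ closedBall y (2 * (ε / 2 ^ n)) ∧ C ⊆ ⋃ k, G k := by
    intro n x hx
    obtain ⟨m, hm⟩ := mem_iUnion.1 hx
    have hm' : x ∈ G (max n m) :=
      monotone_nat_of_le_succ (connectedEnlargement_subset_succ K hε) (le_max_right n m) hm
    obtain ⟨y, hy, C, hC, hyC, hxC, hCb, hCG⟩ :=
      exists_isPreconnected_of_mem_connectedEnlargement K hε (le_max_left n m) x hm'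
    exact ⟨y, hy, C, hC, hyC, hxC, hCb.trans (closedBall_subset_closedBall
      (by linarith [hpos (max n m)])), hCG⟩
  have hGsub : ⋃ n, G n ⊆ cthickening δ K := by
    intro x hx
    obtain ⟨y, hy, C, -, -, hxC, hCb, -⟩ := chain 0 x hx
    refine mem_cthickening_of_dist_le x y δ K hy ?_
    have := mem_closedBall.1 (hCb hxC)
    simp only [pow_zero, div_one] at this
    linarith
  have hcl : closure (⋃ n, G n) ⊆ cthickening δ K := closure_minimal hGsub isClosed_cthickening
  have hGpre : IsPreconnected (⋃ n, G n) := by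
    obtain ⟨p, hp⟩ := hKc.nonempty
    refine isPreconnected_of_forall p fun x hx => ?_
    obtain ⟨y, hy, C, hC, hyC, hxC, -, hCG⟩ := chain 0 x hx
    exact ⟨K ∪ C, union_subset hKG hCG, .inl hp, .inr hxC,
      hKc.isPreconnected.union y hy hyC hC⟩
  have hnhds : ⋃ n, G n ∈ 𝓝ˢ K := by
    refine mem_nhdsSet_iff_forall.2 fun x hx => ?_
    refine mem_of_superset (connectedComponentIn_mem_nhds
      (closedBall_mem_nhds x (hpos 0))) ?_
    exact (subset_biUnion_of_mem (u := fun z => connectedComponentIn (closedBall z (ε / 2 ^ 0)) z)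
      (show x ∈ G 0 from hx)).trans (subset_iUnion G 1)
  have hS : HasPropertyS (⋃ n, G n) := by
    intro η hη
    obtain ⟨n, hn⟩ : ∃ n : ℕ, 3 * (ε / 2 ^ n) ≤ η := by
      obtain ⟨n, hn⟩ := exists_pow_lt_of_lt_one (show 0 < η / (3 * ε) by positivity)
        (show (1 / 2 : ℝ) < 1 by norm_num)
      refine ⟨n, ?_⟩
      rw [lt_div_iff₀ (by positivity), one_div, inv_pow] at hn
      rw [div_eq_mul_inv]
      linarith
    set B : M → Set M := fun y => connectedComponentIn (closedBall y (ε / 2 ^ n / 2)) y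
    have hBnhds : ∀ y, B y ∈ 𝓝 y := fun y =>
      connectedComponentIn_mem_nhds (closedBall_mem_nhds y (half_pos (hpos n)))
    have hcn : IsCompact (closure (G n)) := hcomp.of_isClosed_subset isClosed_closure
      ((closure_mono (subset_iUnion G n)).trans hcl)
    obtain ⟨t, ht, hcov⟩ := hcn.elim_nhds_subcover B fun y _ => hBnhds y
    have hBG : ∀ y ∈ closure (G n), B y ⊆ ⋃ k, G k := by
      intro y hy
      obtain ⟨z, hzB, hzG⟩ := mem_closure_iff_nhds.1 hy _ (hBnhds y)
      have : B y ⊆ connectedComponentIn (closedBall z (ε / 2 ^ n)) z := by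
        refine isPreconnected_connectedComponentIn.subset_connectedComponentIn hzB ?_
        intro w hw
        have h1 := mem_closedBall.1 (connectedComponentIn_subset _ _ hw)
        have h2 := mem_closedBall'.1 (connectedComponentIn_subset _ _ hzB)
        rw [mem_closedBall]
        linarith [dist_triangle w y z]
      exact this.trans ((subset_biUnion_of_mem
        (u := fun z => connectedComponentIn (closedBall z (ε / 2 ^ n)) z) hzG).trans
          (subset_iUnion G (n + 1)))
    refine ⟨(fun y => connectedComponentIn ((⋃ k, G k) ∩ closedBall y (3 * (ε / 2 ^ n))) y) '' t,
      t.finite_toSet.image _, ?_, ?_⟩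
    · refine Subset.antisymm ?_ fun x hx => ?_
      · rintro x ⟨_, ⟨y, -, rfl⟩, hx⟩
        exact (connectedComponentIn_subset _ _ hx).1
      · obtain ⟨z, hz, C, hC, hzC, hxC, hCb, hCG⟩ := chain n x hx
        obtain ⟨y, hyt, hzy⟩ := mem_iUnion₂.1 (hcov (subset_closure hz))
        refine ⟨_, ⟨y, hyt, rfl⟩, ?_⟩
        have hyy : y ∈ B y := mem_connectedComponentIn
          (mem_closedBall_self (half_pos (hpos n)).le)
        refine (isPreconnected_connectedComponentIn.union z hzy hzC hC).subset_connectedComponentIn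
          (.inl hyy) (subset_inter (union_subset (hBG y (ht y hyt)) hCG) ?_) (.inr hxC)
        have h1 := mem_closedBall.1 (connectedComponentIn_subset _ _ hzy)
        refine union_subset ((connectedComponentIn_subset _ _).trans
          (closedBall_subset_closedBall (by linarith [hpos n]))) fun w hw => ?_
        have h2 := mem_closedBall.1 (hCb hw)
        rw [mem_closedBall]
        linarith [dist_triangle w z y, hpos n]
    · rintro _ ⟨y, -, rfl⟩
      exact ⟨isPreconnected_connectedComponentIn, y, (connectedComponentIn_subset _ _).trans
        (inter_subset_right.trans (closedBall_subset_closedBall hn))⟩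
  exact ⟨closure (⋃ n, G n), mem_of_superset hnhds subset_closure, hcl.trans hsub,
    hcomp.of_isClosed_subset isClosed_closure hcl,
    ⟨(hKc.nonempty.mono hKG).closure, hGpre.closure⟩,
    hS.closure.locallyConnectedSpace isClosed_closure⟩

/-- The image of a compact locally connected set under a continuous map to a Hausdorff space is
locally connected. -/
theorem IsCompact.locallyConnectedSpace_image {X Y : Type*} [TopologicalSpace X]
    [TopologicalSpace Y] [T2Space Y] {N : Set X} (hN : IsCompact N) [LocallyConnectedSpace N]
    {f : X → Y} (hf : ContinuousOn f N) : LocallyConnectedSpace (f '' N) := by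
  have := isCompact_iff_compactSpace.1 hN
  let g : N → f '' N := fun x => ⟨f x, mem_image_of_mem f x.2⟩
  have hg : Continuous g := hf.domRestrict.subtype_mk _
  have hs : Function.Surjective g := by
    rintro ⟨_, x, hx, rfl⟩
    exact ⟨⟨x, hx⟩, rfl⟩
  exact (hg.isClosedMap.isQuotientMap hg hs).isCoinducing.locallyConnectedSpace

/-- A continuous action of `ℝ` on `M`. -/
structure IsContinuousFlow (φ : ℝ → M → M) : Prop where
  continuous : Continuous fun p : ℝ × M => φ p.1 p.2
  zero : ∀ x, φ 0 x = x
  add : ∀ s t x, φ s (φ t x) = φ (s + t) x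

section OmegaLimit

variable {φ : ℝ → M → M}

theorem mem_omegaLimitSet_iff {x y : M} :
    y ∈ omegaLimitSet φ x ↔ MapClusterPt y atTop fun t => φ t x := by
  simp only [omegaLimitSet, mem_iInter, mem_closure_iff_nhds, mapClusterPt_iff_frequently,
    frequently_atTop]
  constructor
  · intro h s hs T
    obtain ⟨_, hz, t, ht, rfl⟩ := h (max T 0) (mem_Ici.2 (le_max_right _ _)) s hs
    exact ⟨t, (le_max_left _ _).trans ht, hz⟩
  · intro h T _ s hs
    obtain ⟨t, ht, hts⟩ := h s hs T
    exact ⟨_, hts, t, ht, rfl⟩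

theorem isClosed_omegaLimitSet (x : M) : IsClosed (omegaLimitSet φ x) :=
  isClosed_biInter fun _ _ => isClosed_closure

theorem omegaLimitSet_subset {x : M} {K : Set M} (hK : IsClosed K) {T : ℝ}
    (h : ∀ t ≥ T, φ t x ∈ K) : omegaLimitSet φ x ⊆ K := by
  intro y hy
  by_contra hyK
  obtain ⟨t, ht, htK⟩ := frequently_atTop.1
    ((mem_omegaLimitSet_iff.1 hy).frequently (hK.isOpen_compl.mem_nhds hyK)) T
  exact htK (h t ht)

theorem omegaLimitSet_subset_closure_forwardOrbit (x : M) :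
    omegaLimitSet φ x ⊆ closure ((fun t => φ t x) '' Ici 0) :=
  biInter_subset_of_mem (mem_Ici.2 le_rfl)

theorem nonempty_omegaLimitSet {x : M} {K : Set M} (hK : IsCompact K)
    (hx : ∀ t ≥ (0 : ℝ), φ t x ∈ K) : (omegaLimitSet φ x).Nonempty := by
  obtain ⟨y, -, hy⟩ := hK.exists_mapClusterPt (f := atTop) (u := fun t => φ t x)
    (le_principal_iff.2 (mem_map.2 (mem_of_superset (Ici_mem_atTop 0) hx)))
  exact ⟨y, mem_omegaLimitSet_iff.2 hy⟩

theorem exists_isCompactMinimalSet_subset {K : Set M} (hK : IsCompact K) (hne : K.Nonempty)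
    (hinv : IsFlowInvariant φ K) : ∃ Γ ⊆ K, IsCompactMinimalSet φ Γ := by
  obtain ⟨Γ, hΓK, hΓ⟩ := zorn_superset_nonempty
    {A : Set M | IsCompact A ∧ A.Nonempty ∧ IsFlowInvariant φ A} (by
      intro c hc hchain hcne
      have : Nonempty c := hcne.to_subtype
      have hcl : ∀ A ∈ c, IsClosed A := fun A hA => (hc hA).1.isClosed
      obtain ⟨A, hA⟩ := hcne
      refine ⟨⋂₀ c, ⟨(hc hA).1.of_isClosed_subset (isClosed_sInter hcl) (sInter_subset_of_mem hA),
        ?_, ?_⟩, fun s hs => sInter_subset_of_mem hs⟩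
      · exact IsCompact.nonempty_sInter_of_directed_nonempty_isCompact_isClosed
          (fun A hA B hB => (hchain.total hA hB).elim
            (fun hAB => ⟨A, hA, Subset.rfl, hAB⟩) fun hBA => ⟨B, hB, hBA, Subset.rfl⟩) (fun A hA => (hc hA).2.1)
          (fun A hA => (hc hA).1) hcl
      · exact fun x hx t A hA => (hc hA).2.2 x (hx A hA) t) K ⟨hK, hne, hinv⟩
  refine ⟨Γ, hΓK, hΓ.prop.2.1, hΓ.prop.1, hΓ.prop.2.2, fun A hA hAne hAcl hAinv => ?_⟩
  exact hA.antisymm (hΓ.le_of_le ⟨hΓ.prop.1.of_isClosed_subset hAcl hA, hAne, hAinv⟩ hA)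

end OmegaLimit

namespace IsContinuousFlow

variable {φ : ℝ → M → M}

theorem continuous_time (h : IsContinuousFlow φ) (x : M) : Continuous fun t => φ t x :=
  h.continuous.comp (Continuous.prodMk_left x)

theorem continuous_space (h : IsContinuousFlow φ) (t : ℝ) : Continuous (φ t) :=
  h.continuous.comp (Continuous.prodMk_right t)

theorem reverse (h : IsContinuousFlow φ) : IsContinuousFlow fun t => φ (-t) where
  continuous := h.continuous.comp (by fun_prop : Continuous fun p : ℝ × M => (-p.1, p.2))
  zero x := by simp [h.zero]
  add s t x := by simp only [h.add]; congr 1; ring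

theorem omegaLimitSet_apply_subset (h : IsContinuousFlow φ) (x : M) (t : ℝ) :
    omegaLimitSet φ (φ t x) ⊆ omegaLimitSet φ x := by
  intro y hy
  refine mem_omegaLimitSet_iff.2 (mapClusterPt_iff_frequently.2 fun s hs =>
    frequently_atTop.2 fun T => ?_)
  obtain ⟨r, hr, hrs⟩ := frequently_atTop.1
    ((mem_omegaLimitSet_iff.1 hy).frequently hs) (T - t)
  exact ⟨r + t, by linarith, by rwa [h.add] at hrs⟩

theorem isPosInvariant_closure (h : IsContinuousFlow φ) {V : Set M} (hV : IsPosInvariant φ V) :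
    IsPosInvariant φ (closure V) := fun _ hx t ht =>
  map_mem_closure (h.continuous_space t) hx fun y hy => hV y hy t ht

theorem isFlowInvariant_omegaLimitSet (h : IsContinuousFlow φ) (x : M) :
    IsFlowInvariant φ (omegaLimitSet φ x) := by
  intro y hy t
  rw [mem_omegaLimitSet_iff, mapClusterPt_iff_frequently] at *
  intro s hs
  have := hy _ ((h.continuous_space t).continuousAt.preimage_mem_nhds hs)
  rw [frequently_atTop] at *
  intro T
  obtain ⟨r, hr, hrs⟩ := this (T - t)
  refine ⟨t + r, by linarith, ?_⟩
  rwa [mem_preimage, h.add] at hrs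

/-- A forward orbit entering every neighborhood of a Lyapunov stable compact set has its ω-limit
set inside it. -/
theorem omegaLimitSet_subset_of_isLyapunovStable (h : IsContinuousFlow φ) {Γ : Set M}
    (hΓ : IsCompact Γ) (hs : IsLyapunovStable φ Γ) {x : M}
    (hx : ∀ V ∈ 𝓝ˢ Γ, ∃ t, φ t x ∈ V) : omegaLimitSet φ x ⊆ Γ := by
  have : Γ = ⋂ (δ : ℝ) (_ : 0 < δ), cthickening δ Γ := by
    rw [← closure_eq_iInter_cthickening, hΓ.isClosed.closure_eq]
  rw [this]
  refine subset_iInter₂ fun δ hδ => ?_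
  obtain ⟨V, hV, hVδ, hVp⟩ := hs _ (cthickening_mem_nhdsSet Γ hδ)
  obtain ⟨t, ht⟩ := hx V hV
  refine omegaLimitSet_subset isClosed_cthickening (T := t) fun r hr => hVδ ?_
  have := hVp _ ht (r - t) (by linarith)
  rwa [h.add, sub_add_cancel] at this

theorem omegaLimitSet_eq_of_mem (h : IsContinuousFlow φ) {Γ : Set M}
    (hΓ : IsCompactMinimalSet φ Γ) {x : M} (hx : x ∈ Γ) : omegaLimitSet φ x = Γ := by
  obtain ⟨-, hc, hinv, hmin⟩ := hΓ
  exact hmin _ (omegaLimitSet_subset hc.isClosed (T := 0) fun t _ => hinv x hx t)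
    (nonempty_omegaLimitSet hc fun t _ => hinv x hx t) (isClosed_omegaLimitSet x)
    (h.isFlowInvariant_omegaLimitSet x)

theorem isPreconnected_closure_forwardOrbit (h : IsContinuousFlow φ) (x : M) :
    IsPreconnected (closure ((fun t => φ t x) '' Ici 0)) :=
  (isPreconnected_Ici.image _ (h.continuous_time x).continuousOn).closure

theorem isConnected_of_isCompactMinimalSet (h : IsContinuousFlow φ) {Γ : Set M}
    (hΓ : IsCompactMinimalSet φ Γ) : IsConnected Γ := by
  obtain ⟨x, hx⟩ := hΓ.1
  have : closure ((fun t => φ t x) '' Ici 0) = Γ := by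
    refine Subset.antisymm (closure_minimal ?_ hΓ.2.1.isClosed) ?_
    · rintro _ ⟨t, -, rfl⟩
      exact hΓ.2.2.1 x hx t
    · exact (h.omegaLimitSet_eq_of_mem hΓ hx).symm.subset.trans
        (omegaLimitSet_subset_closure_forwardOrbit x)
  exact ⟨hΓ.1, this ▸ h.isPreconnected_closure_forwardOrbit x⟩

/-- If all compact minimal sets in a compact positively invariant set `P` are Lyapunov stable,
then ω-limit sets of points of `P` are compact minimal subsets of `P`. -/
theorem isCompactMinimalSet_omegaLimitSet (h : IsContinuousFlow φ) {P : Set M} (hP : IsCompact P)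
    (hpos : IsPosInvariant φ P)
    (hstab : ∀ Γ ⊆ P, IsCompactMinimalSet φ Γ → IsLyapunovStable φ Γ) {x : M} (hx : x ∈ P) :
    IsCompactMinimalSet φ (omegaLimitSet φ x) ∧ omegaLimitSet φ x ⊆ P := by
  have hsub : omegaLimitSet φ x ⊆ P :=
    omegaLimitSet_subset hP.isClosed (T := 0) fun t ht => hpos x hx t ht
  obtain ⟨Γ, hΓω, hΓ⟩ := exists_isCompactMinimalSet_subset
    (hP.of_isClosed_subset (isClosed_omegaLimitSet x) hsub)
    (nonempty_omegaLimitSet hP fun t ht => hpos x hx t ht) (h.isFlowInvariant_omegaLimitSet x)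
  have hωΓ : omegaLimitSet φ x ⊆ Γ := by
    refine h.omegaLimitSet_subset_of_isLyapunovStable hΓ.2.1 (hstab Γ (hΓω.trans hsub) hΓ) ?_
    intro V hV
    obtain ⟨y, hy⟩ := hΓ.1
    exact ((mem_omegaLimitSet_iff.1 (hΓω hy)).frequently
      (mem_nhdsSet_iff_forall.1 hV y hy)).exists
  rw [hωΓ.antisymm hΓω]
  exact ⟨hΓ, hΓω.trans hsub⟩

/-- A point of `P` whose negative orbit stays in `P` lies in its own ω-limit set. -/
theorem mem_omegaLimitSet_of_negativeOrbit_subset (h : IsContinuousFlow φ) {P : Set M}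
    (hP : IsCompact P)
    (hstab : ∀ Γ ⊆ P, IsCompactMinimalSet φ Γ → IsLyapunovStable φ Γ) {x : M}
    (hx : (fun t => φ t x) '' Iic (0 : ℝ) ⊆ P) : x ∈ omegaLimitSet φ x := by
  have hneg : ∀ t ≥ (0 : ℝ), φ (-t) x ∈ P := fun t ht => hx ⟨-t, by simpa using ht, rfl⟩
  have hsub : omegaLimitSet (fun t => φ (-t)) x ⊆ P :=
    omegaLimitSet_subset hP.isClosed (T := 0) hneg
  obtain ⟨Γ, hΓα, hΓ⟩ := exists_isCompactMinimalSet_subset (φ := φ)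
    (hP.of_isClosed_subset (isClosed_omegaLimitSet x) hsub)
    (nonempty_omegaLimitSet (φ := fun t => φ (-t)) hP hneg) (fun y hy t => by
      simpa using h.reverse.isFlowInvariant_omegaLimitSet x y hy (-t))
  have hxΓ : x ∈ Γ := by
    have : Γ = ⋂ (δ : ℝ) (_ : 0 < δ), cthickening δ Γ := by
      rw [← closure_eq_iInter_cthickening, hΓ.2.1.isClosed.closure_eq]
    rw [this]
    refine mem_iInter₂.2 fun δ hδ => ?_
    obtain ⟨V, hV, hVδ, hVp⟩ :=
      hstab Γ (hΓα.trans hsub) hΓ _ (cthickening_mem_nhdsSet Γ hδ)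
    obtain ⟨y, hy⟩ := hΓ.1
    obtain ⟨t, ht, htV⟩ := frequently_atTop.1 ((mem_omegaLimitSet_iff.1 (hΓα hy)).frequently
      (mem_nhdsSet_iff_forall.1 hV y hy)) 0
    have := hVp _ htV t ht
    rw [h.add, add_neg_cancel, h.zero] at this
    exact hVδ this
  rwa [h.omegaLimitSet_eq_of_mem hΓ hxΓ]

/-- Orbits starting close to a compact minimal set come close to each of its points. -/
theorem eventually_exists_dist_lt (h : IsContinuousFlow φ) {Γ : Set M}
    (hΓ : IsCompactMinimalSet φ Γ) {ε : ℝ} (hε : 0 < ε) :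
    ∀ᶠ z in 𝓝ˢ Γ, ∀ y ∈ Γ, ∃ t, dist (φ t z) y < ε := by
  obtain ⟨s, hsΓ, hs⟩ := hΓ.2.1.elim_nhds_subcover (fun y => ball y (ε / 2))
    fun y _ => ball_mem_nhds y (half_pos hε)
  have key : ∀ y ∈ s, ∀ᶠ z in 𝓝ˢ Γ, ∃ t, φ t z ∈ ball y (ε / 2) := by
    intro y hy
    refine mem_nhdsSet_iff_forall.2 fun z hz => ?_
    rw [← h.omegaLimitSet_eq_of_mem hΓ hz] at hsΓ
    obtain ⟨t, ht⟩ := ((mem_omegaLimitSet_iff.1 (hsΓ y hy)).frequently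
      (ball_mem_nhds y (half_pos hε))).exists
    exact mem_of_superset ((h.continuous_space t).continuousAt.preimage_mem_nhds
      (isOpen_ball.mem_nhds ht)) fun w hw => ⟨t, hw⟩
  filter_upwards [(Filter.eventually_all_finset s).2 key] with z hz y hy
  obtain ⟨w, hws, hyw⟩ := mem_iUnion₂.1 (hs hy)
  obtain ⟨t, ht⟩ := hz w hws
  refine ⟨t, ?_⟩
  have h1 := mem_ball.1 ht
  have h2 := mem_ball'.1 hyw
  linarith [dist_triangle (φ t z) w y]

/-- The ω-limit map is continuous for the Hausdorff metric on a compact positively invariant set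
in which all compact minimal sets are Lyapunov stable. -/
theorem continuousOn_omegaLimitSet (h : IsContinuousFlow φ) {P : Set M} (hP : IsCompact P)
    (hpos : IsPosInvariant φ P)
    (hstab : ∀ Γ ⊆ P, IsCompactMinimalSet φ Γ → IsLyapunovStable φ Γ)
    {q : M → NonemptyCompacts M} (hq : ∀ x ∈ P, (q x : Set M) = omegaLimitSet φ x) :
    ContinuousOn q P := by
  intro x hx
  rw [ContinuousWithinAt, Metric.tendsto_nhds]
  intro ε hε
  obtain ⟨hΓ, hΓP⟩ := h.isCompactMinimalSet_omegaLimitSet hP hpos hstab hx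
  obtain ⟨δ, hδ, hδV⟩ := (hasBasis_nhdsSet_cthickening hΓ.2.1).mem_iff.1
    (inter_mem (h.eventually_exists_dist_lt hΓ (half_pos hε))
      (thickening_mem_nhdsSet _ (half_pos hε)))
  obtain ⟨V, hV, hVδ, hVp⟩ := hstab _ hΓP hΓ _ (cthickening_mem_nhdsSet _ hδ)
  obtain ⟨y, hy⟩ := hΓ.1
  obtain ⟨t, htV⟩ := ((mem_omegaLimitSet_iff.1 hy).frequently
    (eventually_mem_nhds_iff.2 (mem_nhdsSet_iff_forall.1 hV y hy))).exists
  filter_upwards [mem_nhdsWithin_of_mem_nhds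
    ((h.continuous_space t).continuousAt.preimage_mem_nhds htV), self_mem_nhdsWithin] with z hz hzP
  obtain ⟨hz', hz'P⟩ := h.isCompactMinimalSet_omegaLimitSet hP hpos hstab hzP
  have hsub : omegaLimitSet φ z ⊆ cthickening δ (omegaLimitSet φ x) := by
    refine omegaLimitSet_subset isClosed_cthickening (T := t) fun r hr => hVδ ?_
    have := hVp _ hz (r - t) (by linarith)
    rwa [h.add, sub_add_cancel] at this
  rw [NonemptyCompacts.dist_eq, hq z hzP, hq x hx]
  refine (hausdorffDist_le_of_mem_dist (half_pos hε).le ?_ ?_).trans_lt (half_lt_self hε)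
  · intro w hw
    obtain ⟨y, hy, hwy⟩ := mem_thickening_iff.1 (hδV (hsub hw)).2
    exact ⟨y, hy, hwy.le⟩
  · intro y hy
    obtain ⟨w, hw⟩ := hz'.1
    obtain ⟨r, hr⟩ := (hδV (hsub hw)).1 y hy
    exact ⟨φ r w, hz'.2.2.1 w hw r, by rw [dist_comm]; exact hr.le⟩

end IsContinuousFlow

theorem local_trichotomy_at_compact_minimal [LocallyCompactSpace M] [ConnectedSpace M] [LocallyConnectedSpace M]
    (φ : ℝ → M → M)
    (hφcont : Continuous fun p : ℝ × M => φ p.1 p.2)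
    (hφzero : ∀ x : M, φ 0 x = x)
    (hφadd : ∀ s t : ℝ, ∀ x : M, φ s (φ t x) = φ (s + t) x)
    (Λ : Set M) (hΛ : IsCompactMinimalSet φ Λ) :
    (∀ W ∈ 𝓝ˢ Λ, ∃ Γ : Set M, Γ ⊆ W ∧ IsCompactMinimalSet φ Γ ∧ ¬ IsLyapunovStable φ Γ) ∨
      IsAttractorSet φ Λ ∨
      ∀ W ∈ 𝓝ˢ Λ, ∃ U : Set M, U ⊆ W ∧ U ∈ 𝓝ˢ Λ ∧ IsCompact U ∧ IsConnected U ∧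
        IsPosInvariant φ U ∧
        (∀ Γ : Set M, Γ ⊆ U → IsCompactMinimalSet φ Γ → IsHyperStable φ Γ) ∧
        IsCompact {Γ : NonemptyCompacts M | (Γ : Set M) ⊆ U ∧ IsCompactMinimalSet φ (Γ : Set M)} ∧
        IsConnected {Γ : NonemptyCompacts M | (Γ : Set M) ⊆ U ∧ IsCompactMinimalSet φ (Γ : Set M)} ∧
        LocallyConnectedSpace
          ↥{Γ : NonemptyCompacts M | (Γ : Set M) ⊆ U ∧ IsCompactMinimalSet φ (Γ : Set M)} ∧
        {Γ : NonemptyCompacts M | (Γ : Set M) ⊆ U ∧ IsCompactMinimalSet φ (Γ : Set M)}.Nontrivial ∧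
        ∀ x ∈ U, (IsCompactMinimalSet φ (omegaLimitSet φ x) ∧ omegaLimitSet φ x ⊆ U) ∧
          (x ∉ omegaLimitSet φ x → ¬ ((fun t => φ t x) '' Iic (0 : ℝ) ⊆ U)) := by
  have h : IsContinuousFlow φ := ⟨hφcont, hφzero, hφadd⟩
  by_cases h1 : ∀ W ∈ 𝓝ˢ Λ, ∃ Γ : Set M, Γ ⊆ W ∧ IsCompactMinimalSet φ Γ ∧ ¬ IsLyapunovStable φ Γ
  · exact .inl h1
  by_cases h2 : IsAttractorSet φ Λ
  · exact .inr (.inl h2)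
  refine .inr (.inr fun W hW => ?_)
  push Not at h1
  obtain ⟨W₀, hW₀, hstab₀⟩ := h1
  have hΛstab : IsLyapunovStable φ Λ := hstab₀ Λ (subset_of_mem_nhdsSet hW₀) hΛ
  obtain ⟨δ₀, hδ₀, -, hδW₀⟩ := exists_isCompact_cthickening_subset hΛ.2.1 hW₀
  obtain ⟨V₀, hV₀, hV₀δ, hV₀p⟩ := hΛstab _ (cthickening_mem_nhdsSet Λ hδ₀)
  -- A compact minimal set meeting `V₀` is the closure of a forward orbit in `V₀`.
  have hmeet : ∀ Γ, IsCompactMinimalSet φ Γ → (Γ ∩ V₀).Nonempty → IsLyapunovStable φ Γ := by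
    rintro Γ hΓ ⟨x, hxΓ, hxV⟩
    refine hstab₀ Γ (Subset.trans ?_ hδW₀) hΓ
    rw [← h.omegaLimitSet_eq_of_mem hΓ hxΓ]
    exact omegaLimitSet_subset isClosed_cthickening (T := 0) fun t ht => hV₀δ (hV₀p x hxV t ht)
  have hV₀int : interior V₀ ∈ 𝓝ˢ Λ :=
    isOpen_interior.mem_nhdsSet.2 (subset_interior_iff_mem_nhdsSet.2 hV₀)
  obtain ⟨δ, hδ, hδc, hδW⟩ :=
    exists_isCompact_cthickening_subset hΛ.2.1 (inter_mem hW hV₀int)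
  obtain ⟨V, hV, hVδ, hVp⟩ := hΛstab _ (cthickening_mem_nhdsSet Λ hδ)
  set P := closure V
  have hPδ : P ⊆ cthickening δ Λ := closure_minimal hVδ isClosed_cthickening
  have hP : IsCompact P := hδc.of_isClosed_subset isClosed_closure hPδ
  have hPpos : IsPosInvariant φ P := h.isPosInvariant_closure hVp
  have hPnhds : P ∈ 𝓝ˢ Λ := mem_of_superset hV subset_closure
  have hPV₀ : P ⊆ interior V₀ := fun x hx => (hδW (hPδ hx)).2
  have hstab : ∀ Γ ⊆ P, IsCompactMinimalSet φ Γ → IsLyapunovStable φ Γ := by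
    intro Γ hΓP hΓ
    obtain ⟨x, hx⟩ := hΓ.1
    exact hmeet Γ hΓ ⟨x, hx, interior_subset (hPV₀ (hΓP hx))⟩
  have hω : ∀ x ∈ P, IsCompactMinimalSet φ (omegaLimitSet φ x) ∧ omegaLimitSet φ x ⊆ P :=
    fun x hx => h.isCompactMinimalSet_omegaLimitSet hP hPpos hstab hx
  obtain ⟨N, hN, hNP, hNc, hNconn, hNlc⟩ := exists_isCompact_locallyConnected_nhdsSet hΛ.2.1
    (h.isConnected_of_isCompactMinimalSet hΛ) hPnhds
  have : Nonempty (NonemptyCompacts M) := ⟨⟨⟨Λ, hΛ.2.1⟩, hΛ.1⟩⟩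
  have hqex : ∀ x, ∃ Γ : NonemptyCompacts M, x ∈ P → (Γ : Set M) = omegaLimitSet φ x := by
    intro x
    by_cases hx : x ∈ P
    · exact ⟨⟨⟨_, (hω x hx).1.2.1⟩, (hω x hx).1.1⟩, fun _ => rfl⟩
    · exact ⟨Classical.arbitrary _, fun hx' => absurd hx' hx⟩
  choose q hq using hqex
  have hqcont : ContinuousOn q P := h.continuousOn_omegaLimitSet hP hPpos hstab hq
  have hqN : ContinuousOn q N := hqcont.mono hNP
  have hKc : IsCompact (q '' N) := hNc.image_of_continuousOn hqN
  have hqeq : ∀ x ∈ P, ∀ y ∈ P, omegaLimitSet φ x = omegaLimitSet φ y → q x = q y := by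
    intro x hx y hy hxy
    apply NonemptyCompacts.ext
    rw [hq x hx, hq y hy, hxy]
  have hqmem : ∀ x ∈ P, ∀ Γ : NonemptyCompacts M, IsCompactMinimalSet φ (Γ : Set M) →
      x ∈ (Γ : Set M) → q x = Γ := by
    intro x hx Γ hΓ hxΓ
    apply NonemptyCompacts.ext
    rw [hq x hx, h.omegaLimitSet_eq_of_mem hΓ hxΓ]
  set U : Set M := P ∩ q ⁻¹' (q '' N)
  have hUP : U ⊆ P := inter_subset_left
  have hNU : N ⊆ U := fun x hx => ⟨hNP hx, mem_image_of_mem q hx⟩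
  have hUcl : IsClosed U := hqcont.preimage_isClosed_of_isClosed hP.isClosed hKc.isClosed
  have hUpos : IsPosInvariant φ U := by
    intro x hx t ht
    have hxt := hPpos x hx.1 t ht
    refine ⟨hxt, ?_⟩
    rw [mem_preimage, ← hqeq x hx.1 _ hxt ?_]
    · exact hx.2
    · exact ((hω x hx.1).1.2.2.2 _ (h.omegaLimitSet_apply_subset x t) (hω _ hxt).1.1
        (isClosed_omegaLimitSet _) (h.isFlowInvariant_omegaLimitSet _)).symm
  have hωU : ∀ x ∈ U, omegaLimitSet φ x ⊆ U := fun x hx =>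
    omegaLimitSet_subset hUcl (T := 0) fun t ht => hUpos x hx t ht
  have hset : {Γ : NonemptyCompacts M | (Γ : Set M) ⊆ U ∧ IsCompactMinimalSet φ (Γ : Set M)}
      = q '' N := by
    ext Γ
    constructor
    · rintro ⟨hΓU, hΓ⟩
      obtain ⟨x, hx⟩ := hΓ.1
      rw [← hqmem x (hUP (hΓU hx)) Γ hΓ hx]
      exact (hΓU hx).2
    · rintro ⟨x, hx, rfl⟩
      rw [mem_ofPred_eq, hq x (hNP hx)]
      exact ⟨hωU x (hNU hx), (hω x (hNP hx)).1⟩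
  have hUpre : IsPreconnected U := by
    obtain ⟨p, hp⟩ := hNconn.nonempty
    have horbit : ∀ x ∈ U, closure ((fun t => φ t x) '' Ici 0) ⊆ U := by
      refine fun x hx => closure_minimal ?_ hUcl
      rintro _ ⟨t, ht, rfl⟩
      exact hUpos x hx t ht
    have hself : ∀ x, x ∈ closure ((fun t => φ t x) '' Ici 0) := fun x =>
      subset_closure ⟨0, mem_Ici.2 le_rfl, h.zero x⟩
    refine isPreconnected_of_forall p fun x hx => ?_
    obtain ⟨n, hn, hnx⟩ := hx.2
    have hωnx : omegaLimitSet φ n = omegaLimitSet φ x := by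
      rw [← hq n (hNP hn), hnx, hq x hx.1]
    obtain ⟨y, hy⟩ := (hω x hx.1).1.1
    refine ⟨N ∪ (closure ((fun t => φ t n) '' Ici 0) ∪ closure ((fun t => φ t x) '' Ici 0)),
      union_subset hNU (union_subset (horbit n (hNU hn)) (horbit x hx)), .inl hp,
      .inr (.inr (hself x)), ?_⟩
    exact hNconn.isPreconnected.union n hn (.inl (hself n))
      ((h.isPreconnected_closure_forwardOrbit n).union y
        (omegaLimitSet_subset_closure_forwardOrbit n (hωnx ▸ hy))
        (omegaLimitSet_subset_closure_forwardOrbit x hy)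
        (h.isPreconnected_closure_forwardOrbit x))
  refine ⟨U, fun x hx => (hδW (hPδ hx.1)).1, mem_of_superset hN hNU,
    hP.of_isClosed_subset hUcl hUP, ⟨hNconn.nonempty.mono hNU, hUpre⟩, hUpos, ?_, ?_⟩
  · refine fun Γ hΓU hΓ => ⟨hΓ, V₀, ?_, fun Γ' hΓ' hns => ?_⟩
    · exact subset_interior_iff_mem_nhdsSet.1 ((hΓU.trans hUP).trans hPV₀)
    · by_contra hne
      exact hns (hmeet Γ' hΓ' (nonempty_iff_ne_empty.2 hne))
  rw [hset]
  refine ⟨hKc, hNconn.image q hqN, hNc.locallyConnectedSpace_image hqN, ?_, fun x hx =>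
    ⟨⟨(hω x hx.1).1, hωU x hx⟩, fun hxω hneg =>
      hxω (h.mem_omegaLimitSet_of_negativeOrbit_subset hP hstab (hneg.trans hUP))⟩⟩
  by_contra hns
  rw [Set.not_nontrivial_iff] at hns
  refine h2 ⟨hΛ.1, hΛ.2.1, hΛ.2.2.1, hΛstab, mem_of_superset hN fun x hx => ?_⟩
  obtain ⟨y, hy⟩ := hΛ.1
  have hyN := subset_of_mem_nhdsSet hN hy
  have hxy := hns (mem_image_of_mem q hx) (mem_image_of_mem q hyN)
  have hωx : omegaLimitSet φ x = Λ := by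
    rw [← hq x (hNP hx), hxy, hq y (hNP hyN), h.omegaLimitSet_eq_of_mem hΛ hy]
  exact ⟨hωx ▸ hΛ.1, hωx.subset⟩
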